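/- For every integer a with 0 ≤ a ≤ N+1, every integer m ≥ 0, and every u ∈ ℂ, the duality relation ξ^{(a)}_m(u) · ξ(u + 2a − N − 1 + s) = ξ^{(N−a+1)}_m(u + 2a − N − 1 + s) · ξ(u) holds; equivalently ξ^{(a)}_m(u)/ξ(u) = ξ^{(N−a+1)}_m(u + 2a − N − 1 + s)/ξ(u + 2a − N − 1 + s). -/

import Mathlib

open Complex

noncomputable def oneSubXD (x w : ℂ → ℂ) : ℂ → ℂ := fun u => w u - x u * w (u + 2)

noncomputable def Lop (x : ℕ → ℂ → ℂ) : ℕ → (ℂ → ℂ) → (ℂ → ℂ)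
  | 0 => fun w => w
  | k + 1 => fun w => oneSubXD (x (k + 1)) (Lop x k w)

noncomputable def casorati (N : ℕ) (w : ℕ → ℂ → ℂ) (idx : ℕ → ℕ) (u : ℂ) : ℂ :=
  Matrix.det (Matrix.of fun j k : Fin (N + 1) => w (j.1 + 1) (u + 2 * (idx k.1 : ℂ)))

noncomputable def DsubF (f w : ℂ → ℂ) : ℂ → ℂ := fun u => w (u + 2) - f u * w u

noncomputable def Lfac (f : ℕ → ℂ → ℂ) (Nv : ℕ) : ℕ → (ℂ → ℂ) → (ℂ → ℂ)
  | 0 => fun w => w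
  | a + 1 => fun w => DsubF (f (Nv + 1 - a)) (Lfac f Nv a w)

/-- The indices `0, …, p + m - 1`, split into the block `a, …, a + m - 1` and its complement, both
listed in increasing order. -/
noncomputable def blockEquiv (p m a : ℕ) (ha : a ≤ p) : Fin p ⊕ Fin m ≃ Fin (p + m) :=
  Equiv.ofBijective
    (Sum.elim (fun k => ⟨if k.1 < a then k.1 else k.1 + m, by split_ifs <;> omega⟩)
      (fun j => ⟨a + j.1, by omega⟩))
    ((Fintype.bijective_iff_injective_and_card _).2 ⟨by
      rintro (i | i) (j | j) h <;>
        simp only [Sum.elim_inl, Sum.elim_inr, Fin.mk.injEq] at h <;>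
        [congr 1; exfalso; exfalso; congr 1] <;> (try split_ifs at h) <;> omega, by simp⟩)

theorem blockEquiv_inl_val (p m a : ℕ) (ha : a ≤ p) (k : Fin p) :
    (blockEquiv p m a ha (Sum.inl k)).1 = if k.1 < a then k.1 else k.1 + m := rfl

theorem blockEquiv_inr_val (p m a : ℕ) (ha : a ≤ p) (j : Fin m) :
    (blockEquiv p m a ha (Sum.inr j)).1 = a + j.1 := rfl

theorem blockEquiv_succ_eq_trans_cycleIcc (p m a : ℕ) (ha : a + 1 ≤ p) :
    blockEquiv p m (a + 1) ha = (blockEquiv p m a (by omega)).trans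
      (Fin.cycleIcc ⟨a, by omega⟩ ⟨a + m, by omega⟩) := by
  have : NeZero (p + m) := ⟨by omega⟩
  have hle : (⟨a, by omega⟩ : Fin (p + m)) ≤ ⟨a + m, by omega⟩ := by simp
  ext (i | i)
  · rw [Equiv.trans_apply, blockEquiv_inl_val]
    rcases lt_trichotomy i.1 a with h | h | h
    · rw [Fin.cycleIcc_of_lt (by rw [Fin.lt_def, blockEquiv_inl_val]; simp [h]),
        blockEquiv_inl_val]
      simp [h, h.trans (Nat.lt_succ_self a)]
    · have : blockEquiv p m a (by omega) (Sum.inl i) = ⟨a + m, by omega⟩ := by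
        ext; rw [blockEquiv_inl_val]; simp [h]
      rw [this, Fin.cycleIcc_of_last hle]
      simp [h]
    · rw [Fin.cycleIcc_of_gt (by rw [Fin.lt_def, blockEquiv_inl_val, if_neg (by omega)]; simp [h]),
        blockEquiv_inl_val, if_neg (by omega), if_neg (by omega)]
  · rw [Equiv.trans_apply, blockEquiv_inr_val, Fin.cycleIcc_of_ge_of_lt
      (by rw [Fin.le_def, blockEquiv_inr_val]; simp)
      (by rw [Fin.lt_def, blockEquiv_inr_val]; simp),
      Fin.val_add_one_of_lt' (by rw [blockEquiv_inr_val]; omega), blockEquiv_inr_val]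
    omega

theorem sign_blockEquiv_trans_symm (p m a : ℕ) (ha : a ≤ p) :
    Equiv.Perm.sign ((blockEquiv p m a ha).trans (blockEquiv p m p le_rfl).symm)
      = (-1) ^ (m * (p - a)) := by
  obtain ⟨d, hd⟩ : ∃ d, p = a + d := ⟨p - a, by omega⟩
  induction d generalizing a with
  | zero =>
    obtain rfl : p = a := by omega
    simp
  | succ d ih =>
    have h := ih (a + 1) (by omega) (by omega)
    have hle : (⟨a, by omega⟩ : Fin (p + m)) ≤ ⟨a + m, by omega⟩ := by simp
    set e := blockEquiv p m p le_rfl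
    set τ : Equiv.Perm (Fin (p + m)) := Fin.cycleIcc ⟨a, by omega⟩ ⟨a + m, by omega⟩ with hτ
    have hsplit : (blockEquiv p m (a + 1) (by omega)).trans e.symm =
        ((e.trans τ).trans e.symm) * ((blockEquiv p m a ha).trans e.symm) := by
      rw [blockEquiv_succ_eq_trans_cycleIcc]
      ext x
      simp [τ]
    have hs : Equiv.Perm.sign ((e.trans τ).trans e.symm) = (-1) ^ m := by
      have := Equiv.Perm.sign_symm_trans_trans τ e.symm
      rw [Equiv.symm_symm] at this
      rw [this, hτ, Fin.sign_cycleIcc_of_le hle]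
      simp
    rw [hsplit, map_mul, hs] at h
    have hmul : ((-1 : ℤˣ) ^ m) * (-1) ^ m = 1 := by
      rw [← mul_pow]; simp
    rw [show p - a = (p - (a + 1)) + 1 by omega, mul_add, pow_add, ← h, mul_one, mul_right_comm,
      hmul, one_mul]

/-- Complementary minors of a matrix with columns `v 0, …, v (p + m - 1)` and of a system of
`m` linear relations between its columns, the `k`-th of which expresses `v (p + k)` in terms of
the preceding columns. -/
theorem det_columns_eq_det_relations {R : Type*} [CommRing R] (p m a : ℕ) (ha : a ≤ p)
    (v : ℕ → Fin p → R) (c : ℕ → ℕ → R)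
    (hrel : ∀ k < m, ∀ j, ∑ i : Fin (p + m), v i.1 j * c k i.1 = 0)
    (hzero : ∀ k i, p + k < i → c k i = 0) (hone : ∀ k, c k (p + k) = 1) :
    (-1) ^ (m * (p - a)) *
        (Matrix.of fun j k : Fin p => v (if k.1 < a then k.1 else k.1 + m) j).det =
      (Matrix.of fun j k : Fin p => v k.1 j).det *
        (Matrix.of fun j k : Fin m => c k.1 (a + j.1)).det := by
  let B : Matrix (Fin p ⊕ Fin m) (Fin (p + m)) R := Matrix.of fun r i =>
    Sum.elim (fun j => v i.1 j) (fun j => if i.1 = a + j.1 then 1 else 0) r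
  let C : Matrix (Fin (p + m)) (Fin p ⊕ Fin m) R := Matrix.of fun i r =>
    Sum.elim (fun k => if i.1 = k.1 then 1 else 0) (fun k => c k.1 i.1) r
  have hBC : B * C = Matrix.fromBlocks (Matrix.of fun j k : Fin p => v k.1 j) 0
      (Matrix.of fun (j : Fin m) (k : Fin p) => if k.1 = a + j.1 then 1 else 0)
      (Matrix.of fun j k : Fin m => c k.1 (a + j.1)) := by
    ext (j | j) (k | k) <;> simp only [Matrix.mul_apply, Matrix.of_apply, B, C, Sum.elim_inl,
      Sum.elim_inr, Matrix.fromBlocks_apply₁₁, Matrix.fromBlocks_apply₁₂,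
      Matrix.fromBlocks_apply₂₁, Matrix.fromBlocks_apply₂₂]
    · rw [Finset.sum_eq_single ⟨k.1, by omega⟩]
      · simp
      · intro b _ hb
        rw [if_neg (fun h => hb (Fin.ext h)), mul_zero]
      · simp
    · exact hrel k.1 k.2 j
    · rw [Finset.sum_eq_single ⟨k.1, by omega⟩]
      · simp
      · intro b _ hb
        rw [if_neg (fun h : b.1 = k.1 => hb (Fin.ext h)), mul_zero]
      · simp
    · rw [Finset.sum_eq_single ⟨a + j.1, by omega⟩]
      · simp
      · intro b _ hb
        rw [if_neg (fun h => hb (Fin.ext h)), zero_mul]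
      · simp
  have hB : (B.submatrix id (blockEquiv p m a ha)).det =
      (Matrix.of fun j k : Fin p => v (if k.1 < a then k.1 else k.1 + m) j).det := by
    have : B.submatrix id (blockEquiv p m a ha) = Matrix.fromBlocks
        (Matrix.of fun j k : Fin p => v (if k.1 < a then k.1 else k.1 + m) j)
        (Matrix.of fun (j : Fin p) (k : Fin m) => v (a + k.1) j) 0 1 := by
      ext (j | j) (k | k) <;> simp only [Matrix.submatrix_apply, id, Matrix.of_apply, B,
        Sum.elim_inl, Sum.elim_inr, Matrix.fromBlocks_apply₁₁, Matrix.fromBlocks_apply₁₂,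
        Matrix.fromBlocks_apply₂₁, Matrix.fromBlocks_apply₂₂, blockEquiv_inl_val,
        blockEquiv_inr_val, Matrix.zero_apply, Matrix.one_apply]
      · refine if_neg ?_
        split_ifs <;> omega
      · simp [Fin.ext_iff, eq_comm]
    rw [this, Matrix.det_fromBlocks_zero₂₁, Matrix.det_one, mul_one]
  have hCp : (C.submatrix (blockEquiv p m p le_rfl) id).det = 1 := by
    have : C.submatrix (blockEquiv p m p le_rfl) id = Matrix.fromBlocks 1
        (Matrix.of fun (i : Fin p) (k : Fin m) => c k.1 i.1) 0
        (Matrix.of fun (i k : Fin m) => c k.1 (p + i.1)) := by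
      ext (j | j) (k | k) <;> simp only [Matrix.submatrix_apply, id, Matrix.of_apply, C,
        Sum.elim_inl, Sum.elim_inr, Matrix.fromBlocks_apply₁₁, Matrix.fromBlocks_apply₁₂,
        Matrix.fromBlocks_apply₂₁, Matrix.fromBlocks_apply₂₂, blockEquiv_inl_val,
        blockEquiv_inr_val, Matrix.zero_apply, Matrix.one_apply]
      · simp [Fin.ext_iff]
      · simp
      · refine if_neg ?_
        omega
    rw [this, Matrix.det_fromBlocks_zero₂₁, Matrix.det_one, one_mul,
      Matrix.det_of_isUpperTriangular]
    · simp [hone]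
    · intro i k hik
      exact hzero _ _ (by simpa using hik)
  have hC : (C.submatrix (blockEquiv p m a ha) id).det = (-1) ^ (m * (p - a)) := by
    have := Matrix.det_permute ((blockEquiv p m a ha).trans (blockEquiv p m p le_rfl).symm)
      (C.submatrix (blockEquiv p m p le_rfl) id)
    rw [hCp, sign_blockEquiv_trans_symm, Matrix.submatrix_submatrix] at this
    have hcomp : (blockEquiv p m p le_rfl : Fin p ⊕ Fin m → Fin (p + m)) ∘
        ((blockEquiv p m a ha).trans (blockEquiv p m p le_rfl).symm) = blockEquiv p m a ha := by
      ext x; simp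
    rw [hcomp] at this
    simpa using this
  have hdet := congrArg Matrix.det
    (Matrix.submatrix_mul_equiv B C id (blockEquiv p m a ha) id)
  rw [Matrix.det_mul, Matrix.submatrix_id_id, hBC, Matrix.det_fromBlocks_zero₁₂, hB, hC] at hdet
  rw [← hdet, mul_comm]

/-- The coefficient of `D ^ b` in `(1 - x_k D) ⋯ (1 - x_1 D)`. -/
noncomputable def LopCoeff (x : ℕ → ℂ → ℂ) : ℕ → ℕ → ℂ → ℂ
  | 0, 0 => fun _ => 1
  | 0, _ + 1 => fun _ => 0
  | k + 1, 0 => LopCoeff x k 0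
  | k + 1, b + 1 => fun u => LopCoeff x k (b + 1) u - x (k + 1) u * LopCoeff x k b (u + 2)

theorem LopCoeff_zero_right (x : ℕ → ℂ → ℂ) (k : ℕ) (u : ℂ) : LopCoeff x k 0 u = 1 := by
  induction k with
  | zero => rfl
  | succ k ih => exact ih

theorem LopCoeff_eq_zero_of_lt (x : ℕ → ℂ → ℂ) (k b : ℕ) (h : k < b) (u : ℂ) :
    LopCoeff x k b u = 0 := by
  induction k generalizing b u with
  | zero =>
    obtain ⟨b, rfl⟩ : ∃ c, b = c + 1 := ⟨b - 1, by omega⟩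
    rfl
  | succ k ih =>
    obtain ⟨b, rfl⟩ : ∃ c, b = c + 1 := ⟨b - 1, by omega⟩
    simp only [LopCoeff]
    rw [ih _ (by omega), ih _ (by omega)]
    ring

/-- Expansion of the coefficients along the innermost factor `1 - x_1 D`. -/
theorem LopCoeff_succ_succ_inner (x : ℕ → ℂ → ℂ) (k b : ℕ) (u : ℂ) :
    LopCoeff x (k + 1) (b + 1) u = LopCoeff (fun i => x (i + 1)) k (b + 1) u -
      LopCoeff (fun i => x (i + 1)) k b u * x 1 (u + 2 * b) := by
  induction k generalizing b u with
  | zero => cases b <;> simp [LopCoeff]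
  | succ k ih =>
    change LopCoeff x (k + 1) (b + 1) u - x (k + 2) u * LopCoeff x (k + 1) b (u + 2) = _
    rw [ih]
    cases b with
    | zero => simp [LopCoeff, LopCoeff_zero_right]; ring
    | succ b =>
      rw [ih]
      simp only [LopCoeff]
      rw [show u + 2 + 2 * (b : ℂ) = u + 2 * ((b + 1 : ℕ) : ℂ) by push_cast; ring]
      ring

theorem Lop_eq_sum (x : ℕ → ℂ → ℂ) (k : ℕ) (w : ℂ → ℂ) (u : ℂ) :
    Lop x k w u = ∑ b ∈ Finset.range (k + 1), LopCoeff x k b u * w (u + 2 * b) := by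
  induction k generalizing u with
  | zero => simp [Lop, LopCoeff]
  | succ k ih =>
    simp only [Lop, oneSubXD]
    rw [ih, ih, Finset.sum_range_succ' _ (k + 1)]
    simp only [LopCoeff, sub_mul, Finset.sum_sub_distrib]
    rw [Finset.sum_range_succ (fun b => LopCoeff x k (b + 1) u * w (u + 2 * ((b + 1 : ℕ) : ℂ))),
      LopCoeff_eq_zero_of_lt x k (k + 1) (by omega), Finset.sum_range_succ' _ k, Finset.mul_sum]
    have : ∀ b : ℕ, u + 2 + 2 * (b : ℂ) = u + 2 * ((b + 1 : ℕ) : ℂ) := by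
      intro b; push_cast; ring
    simp only [this, mul_assoc]
    ring

theorem Lfac_eq_sum (x : ℕ → ℂ → ℂ) (N : ℕ) (s : ℂ) (w : ℂ → ℂ) (a : ℕ) (ha : a ≤ N + 1) (u : ℂ) :
    Lfac (fun c v => x c (v + (N : ℂ) + 1 - 2 * c + s)) N a w u =
      ∑ b ∈ Finset.range (a + 1),
        LopCoeff (fun i => x (i + (N + 1 - a))) a b (u + (2 * a - 2 * b - N - 1 + s)) *
          w (u + 2 * ((a : ℂ) - b)) := by
  induction a generalizing u with
  | zero => simp [Lfac, LopCoeff]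
  | succ a ih =>
    have hshift : (fun i => x (i + (N + 1 - a))) = fun i => x (i + 1 + (N + 1 - (a + 1))) := by
      funext i
      congr 1
      omega
    simp only [Lfac, DsubF]
    rw [ih (by omega), ih (by omega), hshift]
    set X := fun i => x (i + 1 + (N + 1 - (a + 1))) with hX
    have hext : ∀ F : ℕ → ℂ, F (a + 1) = 0 →
        ∑ b ∈ Finset.range (a + 1), F b = ∑ b ∈ Finset.range (a + 1), F (b + 1) + F 0 := by
      intro F hF
      rw [← Finset.sum_range_succ', Finset.sum_range_succ _ (a + 1), hF, add_zero]
    rw [hext _ (by rw [LopCoeff_eq_zero_of_lt _ a (a + 1) (by omega), zero_mul]),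
      Finset.sum_range_succ' _ (a + 1), Finset.mul_sum, add_sub_right_comm,
      ← Finset.sum_sub_distrib]
    have h1 : ((N + 1 - a : ℕ) : ℂ) = (N : ℂ) + 1 - a := by
      rw [Nat.cast_sub (by omega)]; push_cast; ring
    have h2 : 1 + (N + 1 - (a + 1)) = N + 1 - a := by omega
    simp only [LopCoeff_zero_right]
    congr 1
    · refine Finset.sum_congr rfl fun b _ => ?_
      rw [LopCoeff_succ_succ_inner]
      simp only [← hX, h1, h2]
      push_cast
      rw [show u + 2 + (2 * (a : ℂ) - 2 * (b + 1) - N - 1 + s) =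
          u + (2 * (a + 1) - 2 * (b + 1) - N - 1 + s) by ring,
        show u + (2 * (a : ℂ) - 2 * b - N - 1 + s) =
          u + (2 * (a + 1) - 2 * (b + 1) - N - 1 + s) by ring,
        show u + 2 + 2 * ((a : ℂ) - (b + 1)) = u + 2 * (a + 1 - (b + 1)) by ring,
        show u + 2 * ((a : ℂ) - b) = u + 2 * (a + 1 - (b + 1)) by ring,
        show u + (N : ℂ) + 1 - 2 * (N + 1 - a) + s =
          u + (2 * (a + 1) - 2 * (b + 1) - N - 1 + s) + 2 * b by ring]
      ring
    · push_cast
      ring_nf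

/-- Duality for the Casoratians of a linear difference equation of odd order `N + 1` with leading
coefficient one whose coefficients are reciprocal up to a shift. -/
theorem casorati_duality_of_coeff_duality (N : ℕ) (hN : Even N) (s : ℂ) (w g : ℕ → ℂ → ℂ)
    (hg : ∀ b, 1 ≤ b → b ≤ N + 1 → ∀ u : ℂ,
      ∑ i ∈ Finset.range (N + 2), g i u * w b (u + 2 * i) = 0)
    (hlead : ∀ u, g (N + 1) u = 1)
    (hdual : ∀ b ≤ N + 1, ∀ u : ℂ, g b u = -g (N + 1 - b) (u + 2 * b - N - 1 + s))
    (a : ℕ) (ha : a ≤ N + 1) (m : ℕ) (u : ℂ) :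
    casorati N w (fun k => if k < a then k else k + m) u *
        casorati N w (fun k => k) (u + 2 * (a : ℂ) - N - 1 + s)
      = casorati N w (fun k => if k < N + 1 - a then k else k + m)
          (u + 2 * (a : ℂ) - N - 1 + s) *
        casorati N w (fun k => k) u := by
  let c : ℂ → ℕ → ℕ → ℂ := fun z k i =>
    if k ≤ i ∧ i ≤ N + 1 + k then g (i - k) (z + 2 * k) else 0
  have hrel : ∀ z : ℂ, ∀ k < m, ∀ j : Fin (N + 1),
      ∑ i : Fin (N + 1 + m), w (j.1 + 1) (z + 2 * (i.1 : ℂ)) * c z k i.1 = 0 := by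
    intro z k hk j
    rw [Fin.sum_univ_eq_sum_range (fun i => w (j.1 + 1) (z + 2 * (i : ℂ)) * c z k i)]
    have hsub : (Finset.range (N + 2)).image (fun i => k + i) ⊆ Finset.range (N + 1 + m) := by
      intro i hi
      simp only [Finset.mem_image, Finset.mem_range] at hi ⊢
      omega
    rw [← Finset.sum_subset hsub, Finset.sum_image (by intro x _ y _ h; simpa using h),
      ← hg (j.1 + 1) (by omega) (by omega) (z + 2 * k)]
    · refine Finset.sum_congr rfl fun i hi => ?_
      rw [Finset.mem_range] at hi
      simp only [c]
      rw [if_pos (by omega), Nat.add_sub_cancel_left, mul_comm]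
      push_cast
      ring_nf
    · intro i _ hi
      simp only [c]
      rw [if_neg, mul_zero]
      rintro ⟨h1, h2⟩
      exact hi (Finset.mem_image.2 ⟨i - k, by simp; omega, by omega⟩)
  have hminor : ∀ z : ℂ, ∀ d ≤ N + 1, (-1) ^ (m * (N + 1 - d)) *
      casorati N w (fun k => if k < d then k else k + m) z = casorati N w (fun k => k) z *
        (Matrix.of fun j k : Fin m => c z k.1 (d + j.1)).det := by
    intro z d hd
    refine det_columns_eq_det_relations (N + 1) m d hd
      (fun i j => w (j.1 + 1) (z + 2 * (i : ℂ))) (c z) (hrel z) ?_ ?_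
    · intro k i hi
      simp only [c]
      exact if_neg (by omega)
    · intro k
      simp only [c]
      rw [if_pos (by omega), Nat.add_sub_cancel, hlead]
  set z := u + 2 * (a : ℂ) - N - 1 + s with hz
  have htranspose : (Matrix.of fun j k : Fin m => c z k.1 (N + 1 - a + j.1)) =
      -(Matrix.of fun j k : Fin m => c u k.1 (a + j.1)).transpose := by
    ext j k
    simp only [Matrix.of_apply, Matrix.neg_apply, Matrix.transpose_apply, c]
    by_cases h : j.1 ≤ a + k.1 ∧ a + k.1 ≤ N + 1 + j.1
    · rw [if_pos h, if_pos (by omega), hdual (a + k.1 - j.1) (by omega), neg_neg,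
        Nat.cast_sub h.1, hz]
      congr 1
      · omega
      · push_cast
        ring
    · rw [if_neg h, if_neg (by omega), neg_zero]
  have h1 := hminor u a ha
  have h2 := hminor z (N + 1 - a) (by omega)
  rw [htranspose, Matrix.det_neg, Matrix.det_transpose, Fintype.card_fin] at h2
  have hsign : (-1 : ℂ) ^ (m * (N + 1 - (N + 1 - a))) * (-1) ^ m = (-1) ^ (m * (N + 1 - a)) := by
    rw [← pow_add]
    refine neg_one_pow_congr ?_
    rw [show N + 1 - (N + 1 - a) = a by omega]
    have : Even (N + 1 - a) ↔ ¬ Even a := by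
      rw [Nat.even_sub ha, Nat.even_add_one]
      tauto
    rw [Nat.even_add, Nat.even_mul, Nat.even_mul, this]
    tauto
  have hsq : ∀ k : ℕ, (-1 : ℂ) ^ k * (-1) ^ k = 1 := fun k => by
    rw [← mul_pow]; simp
  have h1' : casorati N w (fun k => if k < a then k else k + m) u =
      (-1) ^ (m * (N + 1 - a)) * (casorati N w (fun k => k) u *
        (Matrix.of fun j k : Fin m => c u k.1 (a + j.1)).det) := by
    rw [← h1, ← mul_assoc, hsq, one_mul]
  have h2' : casorati N w (fun k => if k < N + 1 - a then k else k + m) z =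
      (-1) ^ (m * (N + 1 - a)) * (casorati N w (fun k => k) z *
        (Matrix.of fun j k : Fin m => c u k.1 (a + j.1)).det) := by
    rw [← hsign]
    calc _ = (-1) ^ (m * (N + 1 - (N + 1 - a))) * ((-1) ^ (m * (N + 1 - (N + 1 - a))) *
          casorati N w (fun k => if k < N + 1 - a then k else k + m) z) := by
            rw [← mul_assoc, hsq, one_mul]
      _ = _ := by rw [h2]; ring
  rw [h1', h2']
  ring

/-- A difference operator of order at most `N` which annihilates `N + 1` functions with
nonvanishing Casoratian is zero. -/
theorem eq_zero_of_sum_mul_eq_zero_of_casorati_ne_zero (N : ℕ) (w : ℕ → ℂ → ℂ) (u : ℂ)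
    (hxi : casorati N w (fun k => k) u ≠ 0) (h : ℕ → ℂ)
    (hsum : ∀ b, 1 ≤ b → b ≤ N + 1 →
      ∑ i ∈ Finset.range (N + 1), h i * w b (u + 2 * i) = 0) (i : ℕ) (hi : i ≤ N) : h i = 0 := by
  have := Matrix.eq_zero_of_mulVec_eq_zero hxi (v := fun k : Fin (N + 1) => h k.1) (by
    ext j
    simp only [Matrix.mulVec, dotProduct, Matrix.of_apply, Pi.zero_apply]
    rw [Fin.sum_univ_eq_sum_range (fun k => w (j.1 + 1) (u + 2 * (k : ℂ)) * h k),
      ← hsum (j.1 + 1) (by omega) (by omega)]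
    exact Finset.sum_congr rfl fun k _ => mul_comm _ _)
  exact congrFun this ⟨i, by omega⟩

theorem LopCoeff_self_of_le (n : ℕ) (Y x : ℕ → ℂ → ℂ) (hY0 : ∀ u, Y 0 u = 1)
    (hYne : ∀ a ≤ n, ∀ u, Y a u ≠ 0)
    (hxa : ∀ a, 1 ≤ a → a ≤ n → ∀ u : ℂ, x a u = Y a (u + a) / Y (a - 1) (u + a + 1))
    (k : ℕ) (hk : k ≤ n) (u : ℂ) : LopCoeff x k k u = (-1) ^ k * Y k (u + k) := by
  induction k generalizing u with
  | zero => simp [LopCoeff, hY0]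
  | succ k ih =>
    simp only [LopCoeff]
    rw [LopCoeff_eq_zero_of_lt x k (k + 1) (by omega), ih (by omega), hxa _ (by omega) hk]
    have h := hYne k (by omega) (u + 2 + k)
    rw [Nat.add_sub_cancel, show u + ((k + 1 : ℕ) : ℂ) + 1 = u + 2 + k by push_cast; ring]
    field_simp
    ring

theorem LopCoeff_self_add (n : ℕ) (s : ℂ) (Y x : ℕ → ℂ → ℂ) (hY0 : ∀ u, Y 0 u = 1)
    (hYne : ∀ a ≤ n, ∀ u, Y a u ≠ 0)
    (hxa : ∀ a, 1 ≤ a → a ≤ n → ∀ u : ℂ, x a u = Y a (u + a) / Y (a - 1) (u + a + 1))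
    (hx0 : ∀ u : ℂ, x (n + 1) u = Y n (u + n + 1 + s) / Y n (u + n + 2))
    (hxbar : ∀ a, 1 ≤ a → a ≤ n → ∀ u : ℂ,
      x (2 * n - a + 2) u = Y (a - 1) (u + 2 * (n : ℂ) - a + 2 + s)
        / Y a (u + 2 * (n : ℂ) - a + 3 + s))
    (j : ℕ) (hj : j ≤ n) (u : ℂ) :
    LopCoeff x (n + 1 + j) (n + 1 + j) u = (-1) ^ (n + 1 + j) * Y (n - j) (u + n + 1 + j + s) := by
  induction j generalizing u with
  | zero =>
    have h := hYne n le_rfl (u + n + 2)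
    simp only [add_zero, LopCoeff]
    rw [LopCoeff_eq_zero_of_lt x n (n + 1) (by omega),
      LopCoeff_self_of_le n Y x hY0 hYne hxa n le_rfl, hx0,
      show u + 2 + (n : ℂ) = u + n + 2 by ring]
    field_simp
    simp
    ring
  | succ j ih =>
    have h := hYne (n - j) (by omega) (u + 2 + n + 1 + j + s)
    change LopCoeff x (n + 1 + j) (n + 1 + j + 1) u -
      x (n + 1 + j + 1) u * LopCoeff x (n + 1 + j) (n + 1 + j) (u + 2) = _
    have hx := hxbar (n - j) (by omega) (by omega) u
    rw [Nat.cast_sub (by omega), show 2 * n - (n - j) + 2 = n + 1 + j + 1 by omega,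
      show n - j - 1 = n - (j + 1) by omega,
      show u + 2 * (n : ℂ) - (n - j) + 3 + s = u + 2 + n + 1 + j + s by ring] at hx
    rw [LopCoeff_eq_zero_of_lt x _ _ (by omega), ih (by omega), hx]
    push_cast
    rw [show u + 2 * (n : ℂ) - (n - j) + 2 + s = u + n + 1 + (j + 1) + s by ring]
    field_simp
    ring

theorem xi_duality_A2_even
    (n : ℕ) (hn : 1 ≤ n) (N : ℕ) (hN : N = 2 * n)
    (hbar : ℂ) (hbar_ne : hbar ≠ 0) (s : ℂ)
    (hs : s = (Real.pi : ℂ) * Complex.I / (2 * hbar))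
    (Q : ℕ → ℂ → ℂ) (hQ0 : ∀ u, Q 0 u = 1)
    (hQne : ∀ a, 1 ≤ a → a ≤ n → ∀ u, Q a u ≠ 0)
    (hconst : ℕ → ℂ)
    (hQper : ∀ a, 1 ≤ a → a ≤ n → hconst a ≠ 0 ∧
      ∀ u, Q a (u + (Real.pi : ℂ) * Complex.I / hbar) = hconst a * Q a u)
    (Y : ℕ → ℂ → ℂ) (hY : ∀ a u, Y a u = Q a (u - 1) / Q a (u + 1))
    (x : ℕ → ℂ → ℂ)
    (hxa : ∀ a, 1 ≤ a → a ≤ n → ∀ u : ℂ,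
      x a u = Y a (u + a) / Y (a - 1) (u + a + 1))
    (hx0 : ∀ u : ℂ, x (n + 1) u = Y n (u + n + 1 + s) / Y n (u + n + 2))
    (hxbar : ∀ a, 1 ≤ a → a ≤ n → ∀ u : ℂ,
      x (2 * n - a + 2) u = Y (a - 1) (u + 2 * (n : ℂ) - a + 2 + s)
        / Y a (u + 2 * (n : ℂ) - a + 3 + s))
    (w : ℕ → ℂ → ℂ)
    (hw : ∀ b, 1 ≤ b → b ≤ N + 1 → ∀ u : ℂ, Lop x (N + 1) (w b) u = 0)
    (hLfac : ∀ a b : ℕ, 1 ≤ b → b ≤ a → a ≤ N + 1 → ∀ u : ℂ,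
      Lfac (fun c v => x c (v + (N : ℂ) + 1 - 2 * c + s)) N a (w b) u = 0)
    (hxi : ∀ u : ℂ, casorati N w (fun k => k) u ≠ 0)
    :
    ∀ a : ℕ, a ≤ N + 1 → ∀ m : ℕ, ∀ u : ℂ,
      casorati N w (fun k => if k < a then k else k + m) u *
        casorati N w (fun k => k) (u + 2 * (a : ℂ) - N - 1 + s)
      = casorati N w (fun k => if k < N + 1 - a then k else k + m)
          (u + 2 * (a : ℂ) - N - 1 + s) *
        casorati N w (fun k => k) u := by
  have hYne : ∀ a ≤ n, ∀ u, Y a u ≠ 0 := by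
    intro a ha u
    have hQ : ∀ v, Q a v ≠ 0 := by
      intro v
      rcases Nat.eq_zero_or_pos a with rfl | h
      · simp [hQ0]
      · exact hQne a h ha v
    rw [hY]
    exact div_ne_zero (hQ _) (hQ _)
  have hY0 : ∀ u, Y 0 u = 1 := fun u => by simp [hY, hQ0]
  have htop : ∀ u, LopCoeff x (N + 1) (N + 1) u = -1 := by
    intro u
    have := LopCoeff_self_add n s Y x hY0 hYne hxa hx0 hxbar n le_rfl u
    rw [Nat.sub_self, hY0, show n + 1 + n = N + 1 by omega, pow_succ,
      Even.neg_one_pow ⟨n, by omega⟩] at this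
    simpa using this
  have hL : ∀ b, 1 ≤ b → b ≤ N + 1 → ∀ u : ℂ,
      ∑ i ∈ Finset.range (N + 2), LopCoeff x (N + 1) i u * w b (u + 2 * i) = 0 := by
    intro b h1 h2 u
    rw [← hw b h1 h2 u, Lop_eq_sum]
  have hL' : ∀ b, 1 ≤ b → b ≤ N + 1 → ∀ u : ℂ, ∑ i ∈ Finset.range (N + 2),
      LopCoeff x (N + 1) (N + 1 - i) (u + 2 * i - N - 1 + s) * w b (u + 2 * i) = 0 := by
    intro b h1 h2 u
    rw [← hLfac (N + 1) b h1 h2 le_rfl u, Lfac_eq_sum x N s (w b) (N + 1) le_rfl,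
      ← Finset.sum_range_reflect]
    refine Finset.sum_congr rfl fun i hi => ?_
    rw [Finset.mem_range] at hi
    rw [show N + 2 - 1 - i = N + 1 - i by omega, show N + 1 - (N + 1 - i) = i by omega,
      Nat.cast_sub (by omega)]
    simp only [Nat.sub_self, add_zero]
    push_cast
    ring_nf
  have hcoeff : ∀ i ≤ N + 1, ∀ u : ℂ, LopCoeff x (N + 1) i u =
      -LopCoeff x (N + 1) (N + 1 - i) (u + 2 * i - N - 1 + s) := by
    intro i hi u
    rw [eq_neg_iff_add_eq_zero]
    rcases Nat.lt_or_ge N i with h | h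
    · obtain rfl : i = N + 1 := by omega
      rw [Nat.sub_self, LopCoeff_zero_right, htop]
      ring
    · refine eq_zero_of_sum_mul_eq_zero_of_casorati_ne_zero N w u (hxi u)
        (fun i => LopCoeff x (N + 1) i u +
          LopCoeff x (N + 1) (N + 1 - i) (u + 2 * i - N - 1 + s)) ?_ i h
      intro b h1 h2
      have hsum := congrArg₂ (· + ·) (hL b h1 h2 u) (hL' b h1 h2 u)
      simp only [← Finset.sum_add_distrib, ← add_mul] at hsum
      rw [Finset.sum_range_succ, Nat.sub_self, LopCoeff_zero_right, htop] at hsum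
      simpa using hsum
  intro a ha m u
  refine casorati_duality_of_coeff_duality N ⟨n, by omega⟩ s w
    (fun i u => -LopCoeff x (N + 1) i u) ?_ ?_ ?_ a ha m u
  · intro b h1 h2 u
    simp only [neg_mul, Finset.sum_neg_distrib, hL b h1 h2 u, neg_zero]
  · intro u
    simp [htop]
  · intro b hb u
    rw [hcoeff b hb u]
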